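/- (Join Transfer.) Let R1, R2 and R3 be relations over attribute sets U1, U2 and U3, respectively, F a filter over U1 ∪ U2 ∪ U3, and w an attribute in U3 ∖ (U1 ∪ U2). If π_{U1}(R1 ⋈ R2) ≡ R1, then R1 ⟕_F (R2 ⋈ σ_{¬isNull(w)} R3) ≡ ρ^{U2∖U1}_{{u/if(¬isNull(w), u, null) | u ∈ U2∖U1}}((R1 ⋈ R2) ⟕_F σ_{¬isNull(w)} R3), i.e., the left-hand side equals the relation obtained from (R1 ⋈ R2) ⟕_F σ_{¬isNull(w)} R3 by replacing, in each tuple, the value of every attribute u ∈ U2 ∖ U1 by the value of if(¬isNull(w), u, null). -/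

import Mathlib

noncomputable section
open Classical

attribute [local instance 10] Classical.propDecidable

namespace RA

variable {A Δ : Type} [DecidableEq A] [DecidableEq Δ]

/-- Three-valued logic: true, false, unknown (error). -/
inductive TV where
  | tt | ff | unk
deriving DecidableEq

/-- Kleene conjunction. -/
def TV.and : TV → TV → TV
  | .ff, _ => .ff
  | _, .ff => .ff
  | .tt, .tt => .tt
  | _, _ => .unk

/-- Kleene negation. -/
def TV.not : TV → TV
  | .tt => .ff
  | .ff => .tt
  | .unk => .unk

mutual
/-- Terms over attributes `A` and domain `Δ`: attributes, constants and conditionals. -/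
inductive Term (A Δ : Type) where
  | attr : A → Term A Δ
  | const : Δ → Term A Δ
  | ite : Filter A Δ → Term A Δ → Term A Δ → Term A Δ

/-- RA filters: `isNull` on a (finite) set of terms, equality, conjunction, negation. -/
inductive Filter (A Δ : Type) where
  | isNull : List (Term A Δ) → Filter A Δ
  | eq : Term A Δ → Term A Δ → Filter A Δ
  | and : Filter A Δ → Filter A Δ → Filter A Δ
  | not : Filter A Δ → Filter A Δ
end

/-- Disjunction: `F1 ∨ F2 = ¬(¬F1 ∧ ¬F2)`. -/
def Filter.or (F1 F2 : Filter A Δ) : Filter A Δ := .not ((Filter.not F1).and (Filter.not F2))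

/-- The tautological filter ⊤ (`isNull` of the empty set of terms is always true). -/
def Filter.tru : Filter A Δ := .isNull []

/-- A tuple over a set of attributes: `none` marks attributes outside the set. -/
abbrev Tuple (A Δ : Type) := A → Option Δ

mutual
/-- Evaluation of a term on a tuple (`null` is the distinguished null value of `Δ`). -/
def Term.eval (null : Δ) (t : Tuple A Δ) : Term A Δ → Δ
  | .attr a => (t a).getD null
  | .const c => c
  | .ite F v v' => if F.eval null t = TV.tt then v.eval null t else v'.eval null t

def Term.evalList (null : Δ) (t : Tuple A Δ) : List (Term A Δ) → List Δ
  | [] => []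
  | v :: vs => v.eval null t :: Term.evalList null t vs

/-- Three-valued evaluation of a filter on a tuple. -/
def Filter.eval (null : Δ) (t : Tuple A Δ) : Filter A Δ → TV
  | .isNull V => if ∀ d ∈ Term.evalList null t V, d = null then .tt else .ff
  | .eq v v' =>
      if v.eval null t = null ∨ v'.eval null t = null then .unk
      else if v.eval null t = v'.eval null t then .tt else .ff
  | .and F1 F2 => (F1.eval null t).and (F2.eval null t)
  | .not F => (F.eval null t).not
end

mutual
/-- Attributes occurring in a term. -/
def Term.attrs : Term A Δ → Finset A
  | .attr a => {a}
  | .const _ => ∅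
  | .ite F v v' => F.attrs ∪ v.attrs ∪ v'.attrs

def Term.attrsList : List (Term A Δ) → Finset A
  | [] => ∅
  | v :: vs => v.attrs ∪ Term.attrsList vs

/-- Attributes occurring in a filter. -/
def Filter.attrs : Filter A Δ → Finset A
  | .isNull V => Term.attrsList V
  | .eq v v' => v.attrs ∪ v'.attrs
  | .and F1 F2 => F1.attrs ∪ F2.attrs
  | .not F => F.attrs
end

/-- A term is over `U` if all its attributes are in `U`. -/
def Term.over (v : Term A Δ) (U : Finset A) : Prop := v.attrs ⊆ U

/-- A filter is over `U` if all its attributes are in `U`. -/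
def Filter.over (F : Filter A Δ) (U : Finset A) : Prop := F.attrs ⊆ U

/-- A tuple is over `U` if its domain is exactly `U`. -/
def Tuple.isOver (t : Tuple A Δ) (U : Finset A) : Prop := ∀ a, (t a).isSome ↔ a ∈ U

/-- A relation is a bag (multiset) of tuples. -/
abbrev Rel (A Δ : Type) := Multiset (Tuple A Δ)

/-- A relation is over `U` if all its tuples are. -/
def Rel.isOver (R : Rel A Δ) (U : Finset A) : Prop := ∀ t ∈ R, t.isOver U

/-- Selection σ_F. -/
def select (null : Δ) (F : Filter A Δ) (R : Rel A Δ) : Rel A Δ :=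
  R.filter (fun t => F.eval null t = .tt)

/-- Restriction of a tuple to the attributes in `U`. -/
def Tuple.restrict (t : Tuple A Δ) (U : Finset A) : Tuple A Δ :=
  fun a => if a ∈ U then t a else none

/-- Projection π_U (bag semantics: multiplicities are added up). -/
def proj (U : Finset A) (R : Rel A Δ) : Rel A Δ := R.map (·.restrict U)

/-- Bag difference: `(R1 ∖ R2)(t) = R1(t)` if `t ∉ R2` and `0` otherwise. -/
def bdiff (R1 R2 : Rel A Δ) : Rel A Δ := R1.filter (fun t => t ∉ R2)

/-- Compatibility of tuples: equal and non-null on the shared attributes. -/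
def Compat (null : Δ) (t1 t2 : Tuple A Δ) : Prop :=
  ∀ a, (t1 a).isSome → (t2 a).isSome → (t1 a = t2 a ∧ t1 a ≠ some null)

/-- `t1 ⊕ t2`: the common extension of two (compatible) tuples. -/
def Tuple.merge (t1 t2 : Tuple A Δ) : Tuple A Δ :=
  fun a => (t1 a).or (t2 a)

/-- Natural join. -/
def join (null : Δ) (R1 R2 : Rel A Δ) : Rel A Δ :=
  (R1.product R2).filterMap
    (fun p => if Compat null p.1 p.2 then some (p.1.merge p.2) else none)

/-- Natural join with a filter: `R1 ⋈_F R2 = σ_F (R1 ⋈ R2)`. -/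
def joinF (null : Δ) (F : Filter A Δ) (R1 R2 : Rel A Δ) : Rel A Δ :=
  select null F (join null R1 R2)

/-- Padding of a tuple with `null` on the attributes of `V`. -/
def Tuple.pad (null : Δ) (V : Finset A) (t : Tuple A Δ) : Tuple A Δ :=
  fun a => if a ∈ V then (t a).or (some null) else t a

/-- Outer union of `R1` over `U1` and `R2` over `U2`:
each relation is padded with nulls on the attributes missing from it. -/
def ounion (null : Δ) (U1 U2 : Finset A) (R1 R2 : Rel A Δ) : Rel A Δ :=
  R1.map (Tuple.pad null (U2 \ U1)) + R2.map (Tuple.pad null (U1 \ U2))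

/-- Left join `R1 ⟕_F R2 = (R1 ⋈_F R2) ⊎ (R1 ∖ π_{U1}(R1 ⋈_F R2))`
for `R1` over `U1` and `R2` over `U2`. -/
def ljoin (null : Δ) (U1 U2 : Finset A) (F : Filter A Δ) (R1 R2 : Rel A Δ) : Rel A Δ :=
  ounion null (U1 ∪ U2) U1 (joinF null F R1 R2) (bdiff R1 (proj U1 (joinF null F R1 R2)))

/-- Natural left join `R1 ⟕ R2 = R1 ⟕_⊤ R2`. -/
def nljoin (null : Δ) (U1 U2 : Finset A) (R1 R2 : Rel A Δ) : Rel A Δ :=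
  ljoin null U1 U2 Filter.tru R1 R2

/-- Extension ν_{u↦v}. -/
def extend (null : Δ) (u : A) (v : Term A Δ) (R : Rel A Δ) : Rel A Δ :=
  R.map (fun t a => if a = u then some (v.eval null t) else t a)

/-- Duplicate elimination δ. -/
def dedup (R : Rel A Δ) : Rel A Δ := R.dedup

/-- Extended renaming ρ^V_{{u/f(u) | u ∈ S}} at the level of tuples:
each attribute `u ∈ S` receives the value of the term `f u` (evaluated on the original
tuple) and the attributes of `V ∖ S` are projected away. -/
def renameFun (null : Δ) (V S : Finset A) (f : A → Term A Δ) (t : Tuple A Δ) : Tuple A Δ :=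
  fun a => if a ∈ S then some ((f a).eval null t) else if a ∈ V then none else t a

/-- Extended renaming ρ^V_{{u/f(u) | u ∈ S}}. -/
def rename (null : Δ) (V S : Finset A) (f : A → Term A Δ) (R : Rel A Δ) : Rel A Δ :=
  R.map (renameFun null V S f)

/-- Renaming of the attribute `uold` into `unew` at the level of tuples. -/
def renameAttrT (unew uold : A) (t : Tuple A Δ) : Tuple A Δ :=
  fun a => if a = unew then t uold else if a = uold then none else t a

/-- `R[unew/uold]`: the relation `R` with the attribute `uold` renamed to `unew`. -/
def renameAttr (unew uold : A) (R : Rel A Δ) : Rel A Δ := R.map (renameAttrT unew uold)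

/-- `coalesce(v, v') = if(¬isNull(v), v, v')`. -/
def Term.coalesce (v v' : Term A Δ) : Term A Δ := .ite (.not (.isNull [v])) v v'

/-- The filter `⋀_{u ∈ K} ¬isNull(u)`. -/
def notNullAll (K : Finset A) : Filter A Δ :=
  K.toList.foldr (fun u acc => (Filter.not (.isNull [.attr u])).and acc) Filter.tru

mutual
/-- `nullify_S`: replace every occurrence of an attribute from `S` by the constant null. -/
def Term.nullify (null : Δ) (S : Finset A) : Term A Δ → Term A Δ
  | .attr a => if a ∈ S then .const null else .attr a
  | .const c => .const c
  | .ite F v v' => .ite (F.nullify null S) (v.nullify null S) (v'.nullify null S)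

def Term.nullifyList (null : Δ) (S : Finset A) : List (Term A Δ) → List (Term A Δ)
  | [] => []
  | v :: vs => v.nullify null S :: Term.nullifyList null S vs

/-- `nullify_S` on filters. -/
def Filter.nullify (null : Δ) (S : Finset A) : Filter A Δ → Filter A Δ
  | .isNull V => .isNull (Term.nullifyList null S V)
  | .eq v v' => .eq (v.nullify null S) (v'.nullify null S)
  | .and F1 F2 => .and (F1.nullify null S) (F2.nullify null S)
  | .not F => .not (F.nullify null S)
end

/-- p-equivalence of filters over `U`: they are ⊤ on the same tuples over `U`. -/
def pequiv (null : Δ) (U : Finset A) (F1 F2 : Filter A Δ) : Prop :=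
  ∀ t : Tuple A Δ, t.isOver U → (F1.eval null t = TV.tt ↔ F2.eval null t = TV.tt)

end RA

namespace RA

variable {A Δ : Type}

theorem join_eq_bind (null : Δ) (R S : Rel A Δ) :
    join null R S =
      R.bind fun t => S.bind fun s => if Compat null t s then {t.merge s} else 0 := by
  have key : ∀ (P : Multiset (Tuple A Δ × Tuple A Δ)),
      P.filterMap (fun p => if Compat null p.1 p.2 then some (p.1.merge p.2) else none)
        = P.bind fun p => if Compat null p.1 p.2 then {p.1.merge p.2} else 0 := by
    intro P
    induction P using Multiset.induction_on with
    | empty => simp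
    | cons p P ih =>
      rw [Multiset.cons_bind, ← ih]
      by_cases h : Compat null p.1 p.2
      · rw [Multiset.filterMap_cons_some _ _ _ (b := p.1.merge p.2) (by simp [h])]
        simp [h]
      · rw [Multiset.filterMap_cons_none _ _ (by simp [h])]
        simp [h]
  unfold join
  rw [key, Multiset.product, Multiset.bind_assoc]
  simp only [Multiset.bind_map]

theorem mem_join {null : Δ} {R S : Rel A Δ} {t : Tuple A Δ} :
    t ∈ join null R S ↔ ∃ r ∈ R, ∃ s ∈ S, Compat null r s ∧ r.merge s = t := by
  rw [join_eq_bind]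
  simp only [Multiset.mem_bind]
  refine exists_congr fun r => and_congr_right fun _ =>
    exists_congr fun s => and_congr_right fun _ => ?_
  by_cases h : Compat null r s <;> simp [h, eq_comm]

theorem compat_merge_assoc (null : Δ) (r s t : Tuple A Δ) :
    (Compat null s t ∧ Compat null r (s.merge t)) ↔
      (Compat null r s ∧ Compat null (r.merge s) t) := by
  simp only [Compat, Tuple.merge, ← forall_and]
  refine forall_congr' fun a => ?_
  cases r a <;> cases s a <;> cases t a <;> simp
  grind

theorem merge_assoc (r s t : Tuple A Δ) : (r.merge s).merge t = r.merge (s.merge t) := by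
  funext a
  simp [Tuple.merge, Option.or_assoc]

theorem join_assoc (null : Δ) (R S T : Rel A Δ) :
    join null (join null R S) T = join null R (join null S T) := by
  simp only [join_eq_bind, Multiset.bind_assoc]
  refine Multiset.bind_congr fun r _ => Multiset.bind_congr fun s _ => ?_
  by_cases hrs : Compat null r s
  · simp only [hrs, if_true, Multiset.singleton_bind]
    refine Multiset.bind_congr fun t _ => ?_
    have := compat_merge_assoc null r s t
    by_cases hst : Compat null s t <;> by_cases h : Compat null r (s.merge t) <;>
      simp_all [merge_assoc]
  · simp only [hrs, if_false, Multiset.zero_bind]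
    symm
    rw [← Multiset.bind_zero T]
    refine Multiset.bind_congr fun t _ => ?_
    have := compat_merge_assoc null r s t
    by_cases hst : Compat null s t <;> by_cases h : Compat null r (s.merge t) <;>
      simp_all

theorem count_bind_replicate {α : Type*} [DecidableEq α] (R : Multiset α) (n : α → ℕ) (a : α) :
    (R.bind fun r => Multiset.replicate (n r) r).count a = R.count a * n a := by
  induction R using Multiset.induction_on with
  | empty => simp
  | cons r R ih =>
    by_cases h : a = r
    · subst h
      simp [ih]
      ring
    · simp [ih, Multiset.count_replicate, Multiset.count_cons_of_ne h, Ne.symm h]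

theorem eval_not_isNull_attr [DecidableEq Δ] (null : Δ) (t : Tuple A Δ) (w : A) :
    (Filter.not (.isNull [.attr w])).eval null t = TV.tt ↔ (t w).getD null ≠ null := by
  simp only [Filter.eval, Term.evalList, Term.eval, List.mem_singleton, forall_eq]
  split_ifs with h <;> simp [h, TV.not]

variable [DecidableEq A]

theorem restrict_merge {r : Tuple A Δ} {U : Finset A} (hr : r.isOver U) (s : Tuple A Δ) :
    (r.merge s).restrict U = r := by
  funext a
  have := hr a
  by_cases ha : a ∈ U <;> cases h : r a <;> simp_all [Tuple.restrict, Tuple.merge]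

theorem isOver_merge {r s : Tuple A Δ} {U V : Finset A} (hr : r.isOver U) (hs : s.isOver V) :
    (r.merge s).isOver (U ∪ V) := by
  intro a
  rw [Finset.mem_union, ← hr a, ← hs a]
  simp [Tuple.merge]

theorem proj_join (null : Δ) {U : Finset A} {R : Rel A Δ} (hR : R.isOver U) (S : Rel A Δ) :
    proj U (join null R S) =
      R.bind fun r => Multiset.replicate (S.filter (Compat null r)).card r := by
  rw [join_eq_bind, proj, Multiset.map_bind]
  refine Multiset.bind_congr fun r hr => ?_
  rw [Multiset.map_bind]
  induction S using Multiset.induction_on with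
  | empty => simp
  | cons s S ih =>
    rw [Multiset.cons_bind, ih]
    by_cases h : Compat null r s
    · simp [h, restrict_merge (hR r hr), Multiset.replicate_succ]
    · simp [h]

/-- If projecting a join back to its left operand gives the left operand, then every tuple of
the left operand has exactly one join partner. -/
theorem card_compat_eq_one {null : Δ} {U : Finset A} {R S : Rel A Δ} (hR : R.isOver U)
    (h : proj U (join null R S) = R) {r : Tuple A Δ} (hr : r ∈ R) :
    (S.filter (Compat null r)).card = 1 := by
  have hc := count_bind_replicate R (fun r => (S.filter (Compat null r)).card) r
  rw [← proj_join null hR S, h] at hc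
  have hpos := Multiset.count_pos.2 hr
  exact (Nat.eq_of_mul_eq_mul_left hpos (by rw [mul_one]; exact hc)).symm

theorem restrict_injOn_join {null : Δ} {U : Finset A} {R S : Rel A Δ} (hR : R.isOver U)
    (h : proj U (join null R S) = R) {t t' : Tuple A Δ} (ht : t ∈ join null R S)
    (ht' : t' ∈ join null R S) (he : t.restrict U = t'.restrict U) : t = t' := by
  obtain ⟨r, hr, s, hs, hc, rfl⟩ := mem_join.1 ht
  obtain ⟨r', hr', s', hs', hc', rfl⟩ := mem_join.1 ht'
  rw [restrict_merge (hR r hr), restrict_merge (hR r' hr')] at he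
  subst he
  obtain ⟨x, hx⟩ := Multiset.card_eq_one.1 (card_compat_eq_one hR h hr)
  have h1 : s ∈ S.filter (Compat null r) := Multiset.mem_filter.2 ⟨hs, hc⟩
  have h2 : s' ∈ S.filter (Compat null r) := Multiset.mem_filter.2 ⟨hs', hc'⟩
  rw [hx, Multiset.mem_singleton] at h1 h2
  rw [h1, h2]

theorem renameFun_nullify_of_eval [DecidableEq Δ] {null : Δ} {t : Tuple A Δ} {G : Filter A Δ} {V : Finset A}
    (hG : G.eval null t = TV.tt) (hV : ∀ u ∈ V, (t u).isSome) :
    renameFun null V V (fun u => .ite G (.attr u) (.const null)) t = t := by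
  funext a
  by_cases ha : a ∈ V
  · obtain ⟨x, hx⟩ := Option.isSome_iff_exists.1 (hV a ha)
    simp [renameFun, ha, Term.eval, hG, hx]
  · simp [renameFun, ha]

theorem renameFun_nullify_of_not_eval [DecidableEq Δ] {null : Δ} {t : Tuple A Δ} {G : Filter A Δ}
    {V : Finset A} (hG : G.eval null t ≠ TV.tt) :
    renameFun null V V (fun u => .ite G (.attr u) (.const null)) t =
      fun a => if a ∈ V then some null else t a := by
  funext a
  by_cases ha : a ∈ V <;> simp [renameFun, ha, Term.eval, hG]

theorem ljoin_eq [DecidableEq Δ] (null : Δ) (U V : Finset A) (F : Filter A Δ) (R S : Rel A Δ) :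
    ljoin null U V F R S =
      joinF null F R S +
        (R.filter fun t => t ∉ proj U (joinF null F R S)).map (Tuple.pad null (V \ U)) := by
  have h1 : U \ (U ∪ V) = ∅ := by simp
  have h2 : (U ∪ V) \ U = V \ U := by grind
  have h3 : Tuple.pad null (∅ : Finset A) = (id : Tuple A Δ → Tuple A Δ) := by
    funext t a
    simp [Tuple.pad]
  rw [ljoin, ounion, h1, h2, h3, Multiset.map_id]
  rfl

end RA

namespace RA

variable {A Δ : Type} [DecidableEq A] [DecidableEq Δ]

theorem stmt13 (null : Δ) (U1 U2 U3 : Finset A) (R1 R2 R3 : Rel A Δ) (F : Filter A Δ) (w : A)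
    (hR1 : R1.isOver U1) (hR2 : R2.isOver U2) (hR3 : R3.isOver U3)
    (hF : F.over (U1 ∪ U2 ∪ U3)) (hw : w ∈ U3 \ (U1 ∪ U2))
    (hmain : proj U1 (join null R1 R2) = R1) :
    ljoin null U1 (U2 ∪ U3) F R1 (join null R2 (select null (.not (.isNull [.attr w])) R3))
      = rename null (U2 \ U1) (U2 \ U1)
          (fun u => .ite (.not (.isNull [.attr w])) (.attr u) (.const null))
          (ljoin null (U1 ∪ U2) U3 F (join null R1 R2)
            (select null (.not (.isNull [.attr w])) R3)) := by
  set G : Filter A Δ := .not (.isNull [.attr w]) with hG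
  set T := select null G R3 with hT
  set M := join null R1 R2 with hM
  set J := joinF null F M T with hJ
  have hMover : M.isOver (U1 ∪ U2) := by
    intro t ht
    obtain ⟨r, hr, s, hs, -, rfl⟩ := mem_join.1 ht
    exact isOver_merge (hR1 r hr) (hR2 s hs)
  have hJmem : ∀ j ∈ J, ∃ m ∈ M, ∃ t ∈ T, m.merge t = j := by
    intro j hj
    obtain ⟨m, hm, t, ht, -, h⟩ := mem_join.1 (Multiset.mem_filter.1 hj).1
    exact ⟨m, hm, t, ht, h⟩
  obtain ⟨hw3, hw12⟩ := Finset.mem_sdiff.1 hw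
  have hmw : ∀ m ∈ M, m w = none := fun m hm => by
    simpa [hw12] using (hMover m hm w)
  have hJ' : joinF null F R1 (join null R2 T) = J := by
    rw [hJ, joinF, joinF, hM, join_assoc]
  have hrename : ∀ j ∈ J, renameFun null (U2 \ U1) (U2 \ U1)
      (fun u => .ite G (.attr u) (.const null)) j = j := by
    intro j hj
    obtain ⟨m, hm, t, ht, rfl⟩ := hJmem j hj
    refine renameFun_nullify_of_eval ?_ fun u hu => ?_
    · have := (eval_not_isNull_attr null t w).1 (Multiset.mem_filter.1 ht).2
      rw [hG, eval_not_isNull_attr]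
      simpa [Tuple.merge, hmw m hm] using this
    · have hu' : (m u).isSome := (hMover m hm u).2 (by grind)
      simp [Tuple.merge, hu']
  have hmem : ∀ m ∈ M, (m.restrict U1 ∈ proj U1 J ↔ m ∈ proj (U1 ∪ U2) J) := by
    intro m hm
    simp only [proj, Multiset.mem_map]
    constructor
    · rintro ⟨j, hj, h⟩
      refine ⟨j, hj, ?_⟩
      obtain ⟨m', hm', t, ht, rfl⟩ := hJmem j hj
      rw [restrict_merge (hMover m' hm')]
      refine restrict_injOn_join hR1 hmain hm' hm ?_
      rw [← h]
      funext a
      by_cases ha : a ∈ U1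
      · have := (hMover m' hm' a).2 (by grind)
        obtain ⟨x, hx⟩ := Option.isSome_iff_exists.1 this
        simp [Tuple.restrict, Tuple.merge, hx]
      · simp [Tuple.restrict, ha]
    · rintro ⟨j, hj, h⟩
      refine ⟨j, hj, ?_⟩
      rw [← h]
      funext a
      by_cases ha : a ∈ U1 <;> simp [Tuple.restrict, ha]
  rw [ljoin_eq, ljoin_eq, hJ', ← hJ, rename, Multiset.map_add]
  congr 1
  · rw [Multiset.map_congr rfl hrename, Multiset.map_id']
  · have hR1M : R1 = M.map (·.restrict U1) := hmain.symm
    conv_lhs => rw [hR1M]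
    rw [Multiset.filter_map, Multiset.map_map, Multiset.map_map,
      Multiset.filter_congr (p := (fun t => t ∉ proj U1 J) ∘ (·.restrict U1))
        (q := fun m => m ∉ proj (U1 ∪ U2) J)
      fun m hm => not_congr (hmem m hm)]
    refine Multiset.map_congr rfl fun m hm => ?_
    have hm := (Multiset.mem_filter.1 hm).1
    have hnull : G.eval null (Tuple.pad null (U3 \ (U1 ∪ U2)) m) ≠ TV.tt := by
      rw [hG, ne_eq, eval_not_isNull_attr]
      simp [Tuple.pad, hw3, hmw m hm]
      grind
    simp only [Function.comp_apply]
    rw [renameFun_nullify_of_not_eval hnull]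
    funext a
    have hma := hMover m hm a
    clear * - hma
    by_cases h1 : a ∈ U1 <;> by_cases h2 : a ∈ U2 <;> by_cases h3 : a ∈ U3 <;>
      simp_all [Tuple.pad, Tuple.restrict]

end RA
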